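/- arXiv:1508.04918 — 2 statements merged into one kernel-verified Lean document; each statement's English description precedes it below -/
import Mathlib

section
/- For all real s,t > 0 and θ > 0, the product of two Gamma distributions with shape s+t and scale θ is invariant for the generalized Immediate Exchange Model: for every bounded measurable function f on [0,∞)², ∫∫ (∫₀¹∫₀¹ f(x(1−u)+yv, y(1−v)+xu) φ_{s,t}(u,v) du dv) ν_θ^{s+t}(dx) ν_θ^{s+t}(dy) = ∫∫ f(x,y) ν_θ^{s+t}(dx) ν_θ^{s+t}(dy), where ν_θ^{s+t} has density x^{s+t−1} e^{−x/θ}/(Γ(s+t) θ^{s+t}) on [0,∞). -/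
open MeasureTheory Real

/-- The Beta function `B(s,t) = Γ(s)Γ(t)/Γ(s+t)`. -/
noncomputable def betaFn (s t : ℝ) : ℝ := Real.Gamma s * Real.Gamma t / Real.Gamma (s + t)

/-- Joint density of two independent Beta(s,t) random variables. -/
noncomputable def phiBeta (s t u v : ℝ) : ℝ :=
  (1 / betaFn s t) ^ 2 * u ^ (s - 1) * (1 - u) ^ (t - 1) * v ^ (s - 1) * (1 - v) ^ (t - 1)

/-- The Gamma distribution with shape parameter `a` and scale parameter `θ`:
the measure on [0,∞) with density `x^{a−1} e^{−x/θ}/(Γ(a) θ^a)`. -/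
noncomputable def gammaDist (a θ : ℝ) : Measure ℝ :=
  (volume.restrict (Set.Ici (0 : ℝ))).withDensity
    (fun x => ENNReal.ofReal (x ^ (a - 1) * Real.exp (-x / θ) / (Real.Gamma a * θ ^ a)))

open ProbabilityTheory in
lemma iem_mid (μ ν ρ σ : Measure ℝ) [SFinite μ] [SFinite ν] [SFinite ρ] [SFinite σ] :
    MeasurePreserving (fun q : (ℝ × ℝ) × (ℝ × ℝ) => ((q.1.1, q.2.1), (q.1.2, q.2.2)))
      ((μ.prod ν).prod (ρ.prod σ)) ((μ.prod ρ).prod (ν.prod σ)) := by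
  refine ⟨by fun_prop, ?_⟩
  refine Measure.ext_of_lintegral _ fun g hg => ?_
  rw [lintegral_map hg (by fun_prop)]
  rw [lintegral_prod _ (by fun_prop), lintegral_prod _ (by fun_prop),
    lintegral_prod _ (by fun_prop), lintegral_prod _ (by fun_prop)]
  refine lintegral_congr fun x => ?_
  have h1 : ∀ y, ∫⁻ z : ℝ × ℝ, g ((x, z.1), (y, z.2)) ∂(ρ.prod σ)
      = ∫⁻ z, ∫⁻ w, g ((x, z), (y, w)) ∂σ ∂ρ := fun y => lintegral_prod _ (by fun_prop)
  have h2 : ∀ z, ∫⁻ y : ℝ × ℝ, g ((x, z), y) ∂(ν.prod σ)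
      = ∫⁻ y, ∫⁻ w, g ((x, z), (y, w)) ∂σ ∂ν := fun y => lintegral_prod _ (by fun_prop)
  simp only [h1, h2]
  refine lintegral_lintegral_swap (Measurable.aemeasurable ?_)
  unfold Function.uncurry
  fun_prop

open ProbabilityTheory in
lemma iem_pdf (s t r a b : ℝ) (hs : 0 < s) (ht : 0 < t) (hr : 0 < r) (ha : a ≠ 0) (hb : b ≠ 0) :
    ENNReal.ofReal |(a + b)⁻¹| * (gammaPDF (s + t) r (a + b) * betaPDF s t (a / (a + b)))
      = gammaPDF s r a * gammaPDF t r b := by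
  rcases lt_trichotomy (a + b) 0 with h | h | h
  · rw [gammaPDF_of_neg h]
    rcases lt_or_gt_of_ne ha with ha | ha
    · simp [gammaPDF_of_neg ha]
    · have : b < 0 := by linarith
      simp [gammaPDF_of_neg this]
  · rw [h]
    simp only [inv_zero, abs_zero, ENNReal.ofReal_zero, zero_mul]
    rcases lt_or_gt_of_ne ha with ha | ha
    · simp [gammaPDF_of_neg ha]
    · have : b < 0 := by linarith
      simp [gammaPDF_of_neg this]
  · rcases lt_or_gt_of_ne ha with ha | ha
    · rw [gammaPDF_of_neg ha, betaPDF_eq_zero_of_nonpos (div_nonpos_of_nonpos_of_nonneg ha.le h.le)]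
      simp
    rcases lt_or_gt_of_ne hb with hb | hb
    · rw [gammaPDF_of_neg hb, betaPDF_eq_zero_of_one_le (by rw [le_div_iff₀ h]; linarith)]
      simp
    have hu : a / (a + b) < 1 := by rw [div_lt_one h]; linarith
    have hp : 0 < a / (a + b) := by positivity
    rw [gammaPDF_of_nonneg h.le, gammaPDF_of_nonneg ha.le, gammaPDF_of_nonneg hb.le,
      betaPDF_of_pos_lt_one hp hu, abs_of_pos (by positivity)]
    have g1 := Real.Gamma_pos_of_pos hs
    have g2 := Real.Gamma_pos_of_pos ht
    have g3 := Real.Gamma_pos_of_pos (add_pos hs ht)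
    rw [← ENNReal.ofReal_mul (by positivity), ← ENNReal.ofReal_mul (by positivity),
      ← ENNReal.ofReal_mul (by positivity)]
    congr 1
    have e1 : 1 - a / (a + b) = b / (a + b) := by field_simp; ring
    have e2 : (a + b) ^ (s + t - 1) = (a + b) ^ (s - 1) * (a + b) ^ (t - 1) * (a + b) := by
      rw [← Real.rpow_add h, ← Real.rpow_add_one h.ne']; congr 1; ring
    have e3 : Real.exp (-(r * (a + b))) = Real.exp (-(r * a)) * Real.exp (-(r * b)) := by
      rw [← Real.exp_add]; congr 1; ring
    have p1 : 0 < (a + b) ^ (s - 1) := Real.rpow_pos_of_pos h _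
    have p2 : 0 < (a + b) ^ (t - 1) := Real.rpow_pos_of_pos h _
    rw [e1, e2, e3, Real.div_rpow ha.le h.le, Real.div_rpow hb.le h.le, Real.rpow_add hr, beta]
    field_simp

open ProbabilityTheory in
lemma iem_split (s t r : ℝ) (hs : 0 < s) (ht : 0 < t) (hr : 0 < r) :
    MeasurePreserving (fun q : ℝ × ℝ => (q.1 * q.2, q.1 * (1 - q.2)))
      ((gammaMeasure (s + t) r).prod (betaMeasure s t))
      ((gammaMeasure s r).prod (gammaMeasure t r)) := by
  have mg : ∀ a, Measurable (gammaPDF a r) := fun a =>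
    (measurable_gammaPDFReal a r).ennreal_ofReal
  have mb : Measurable (betaPDF s t) := (measurable_betaPDFReal s t).ennreal_ofReal
  have := isProbabilityMeasure_gammaMeasure hs hr
  have := isProbabilityMeasure_gammaMeasure ht hr
  have := isProbabilityMeasure_gammaMeasure (add_pos hs ht) hr
  have := isProbabilityMeasureBeta hs ht
  have mgs := mg s
  have mgt := mg t
  have mgst := mg (s + t)
  refine ⟨by fun_prop, ?_⟩
  refine Measure.ext_of_lintegral _ fun g hg => ?_
  rw [lintegral_map hg (by fun_prop), lintegral_prod _ (by fun_prop),
    lintegral_prod _ (by fun_prop)]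
  simp only [gammaMeasure, betaMeasure]
  rw [lintegral_withDensity_eq_lintegral_mul _ mgst (by
      exact Measurable.lintegral_prod_right' (ν := volume.withDensity (betaPDF s t))
        (f := fun q : ℝ × ℝ => g (q.1 * q.2, q.1 * (1 - q.2))) (by fun_prop)),
    lintegral_withDensity_eq_lintegral_mul _ mgs (by
      exact Measurable.lintegral_prod_right' (ν := volume.withDensity (gammaPDF t r)) hg)]
  have ne0 : ∀ᵐ x : ℝ, x ≠ 0 := by simp [ae_iff]
  calc _ = ∫⁻ x, ∫⁻ a, ENNReal.ofReal |x⁻¹| * (gammaPDF (s + t) r x * betaPDF s t (a / x))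
            * g (a, x - a) := by
        refine lintegral_congr_ae ?_
        filter_upwards [ne0] with x hx
        simp only [Pi.mul_apply]
        rw [lintegral_withDensity_eq_lintegral_mul _ mb (by fun_prop)]
        rw [← lintegral_const_mul _ (by fun_prop)]
        conv_rhs => rw [← Real.smul_map_volume_mul_left hx]
        rw [lintegral_smul_measure, lintegral_map (by fun_prop) (by fun_prop), smul_eq_mul,
          ← lintegral_const_mul _ (by fun_prop)]
        refine lintegral_congr fun u => ?_
        have e : ENNReal.ofReal |x| * ENNReal.ofReal |x⁻¹| = 1 := by
          rw [← ENNReal.ofReal_mul (abs_nonneg _), ← abs_mul, mul_inv_cancel₀ hx]; simp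
        have e2 : x * u / x = u := by field_simp
        have e3 : x - x * u = x * (1 - u) := by ring
        rw [e2, e3, mul_assoc (ENNReal.ofReal |x⁻¹|), ← mul_assoc (ENNReal.ofReal |x|), e, one_mul,
          Pi.mul_apply, mul_assoc]
    _ = ∫⁻ a, ∫⁻ x, ENNReal.ofReal |x⁻¹| * (gammaPDF (s + t) r x * betaPDF s t (a / x))
            * g (a, x - a) := by
        refine lintegral_lintegral_swap (Measurable.aemeasurable ?_)
        unfold Function.uncurry
        fun_prop
    _ = ∫⁻ a, ∫⁻ b, ENNReal.ofReal |(a + b)⁻¹|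
            * (gammaPDF (s + t) r (a + b) * betaPDF s t (a / (a + b))) * g (a, b) := by
        refine lintegral_congr fun a => ?_
        rw [← lintegral_add_left_eq_self _ a]
        simp only [add_sub_cancel_left]
    _ = _ := by
        refine lintegral_congr_ae ?_
        filter_upwards [ne0] with a ha
        simp only [Pi.mul_apply]
        rw [lintegral_withDensity_eq_lintegral_mul _ mgt (by fun_prop),
          ← lintegral_const_mul _ (by fun_prop)]
        refine lintegral_congr_ae ?_
        filter_upwards [ne0] with b hb
        rw [iem_pdf s t r a b hs ht hr ha hb, Pi.mul_apply, mul_assoc]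

open ProbabilityTheory in
lemma iem_add (s t r : ℝ) (hs : 0 < s) (ht : 0 < t) (hr : 0 < r) :
    MeasurePreserving (fun q : ℝ × ℝ => q.1 + q.2)
      ((gammaMeasure s r).prod (gammaMeasure t r)) (gammaMeasure (s + t) r) := by
  have := isProbabilityMeasure_gammaMeasure (add_pos hs ht) hr
  have := isProbabilityMeasureBeta hs ht
  refine ⟨by fun_prop, ?_⟩
  rw [← (iem_split s t r hs ht hr).map_eq, Measure.map_map (by fun_prop) (by fun_prop)]
  have : ((fun q : ℝ × ℝ => q.1 + q.2) ∘ fun q : ℝ × ℝ => (q.1 * q.2, q.1 * (1 - q.2)))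
      = Prod.fst := by
    ext q; simp only [Function.comp]; ring
  rw [this]
  exact measurePreserving_fst.map_eq

open ProbabilityTheory in
lemma iem_gamma (a θ : ℝ) (hθ : 0 < θ) : gammaDist a θ = gammaMeasure a θ⁻¹ := by
  rw [gammaDist, gammaMeasure, ← withDensity_indicator measurableSet_Ici]
  congr 1
  ext x
  by_cases hx : 0 ≤ x
  · rw [Set.indicator_of_mem (by exact hx), gammaPDF_of_nonneg hx, Real.inv_rpow hθ.le]
    congr 1
    have : -x / θ = -(θ⁻¹ * x) := by field_simp
    rw [this]
    have := Real.rpow_pos_of_pos hθ a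
    simp only [div_eq_mul_inv, mul_inv]; ring
  · rw [Set.indicator_of_notMem (by exact hx), gammaPDF_of_neg (not_le.mp hx)]

open ProbabilityTheory in
lemma iem_beta (s t : ℝ) (hs : 0 < s) (ht : 0 < t) (g : ℝ → ℝ) :
    ∫ u in (0:ℝ)..1, g u * (1 / betaFn s t * u ^ (s - 1) * (1 - u) ^ (t - 1))
      = ∫ u, g u ∂(betaMeasure s t) := by
  have mb : Measurable (betaPDF s t) := (measurable_betaPDFReal s t).ennreal_ofReal
  rw [betaMeasure, integral_withDensity_eq_integral_toReal_smul mb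
    (Filter.Eventually.of_forall fun x => ENNReal.ofReal_lt_top),
    intervalIntegral.integral_of_le zero_le_one, integral_Ioc_eq_integral_Ioo,
    ← integral_indicator measurableSet_Ioo]
  congr 1
  ext x
  by_cases hx : x ∈ Set.Ioo (0:ℝ) 1
  · rw [Set.indicator_of_mem hx, betaPDF,
      ENNReal.toReal_ofReal (betaPDFReal_pos hx.1 hx.2 hs ht).le, betaPDFReal,
      if_pos (show 0 < x ∧ x < 1 from hx)]
    simp only [smul_eq_mul, betaFn, beta]; ring
  · rw [Set.indicator_of_notMem hx, betaPDF, betaPDFReal, if_neg (show ¬ (0 < x ∧ x < 1) from hx)]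
    simp

/-- For s,t > 0 and θ > 0, the product of two Gamma(s+t, θ) distributions is
invariant for the generalized Immediate Exchange Model: for every bounded measurable f,
∫∫ (∫₀¹∫₀¹ f(x(1−u)+yv, y(1−v)+xu) φ_{s,t}(u,v) du dv) dν_θ^{s+t} dν_θ^{s+t} = ∫∫ f dν dν. -/
theorem gamma_product_invariant_generalized
    (s t θ : ℝ) (hs : 0 < s) (ht : 0 < t) (hθ : 0 < θ)
    (f : ℝ × ℝ → ℝ) (hf : Measurable f) (C : ℝ) (hbound : ∀ p, |f p| ≤ C) :
    (∫ p : ℝ × ℝ, (∫ u in (0:ℝ)..1, ∫ v in (0:ℝ)..1,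
        f (p.1 * (1 - u) + p.2 * v, p.2 * (1 - v) + p.1 * u) * phiBeta s t u v)
      ∂((gammaDist (s + t) θ).prod (gammaDist (s + t) θ)))
    = ∫ p : ℝ × ℝ, f p ∂((gammaDist (s + t) θ).prod (gammaDist (s + t) θ)) := by
  rw [iem_gamma _ _ hθ]
  have hr : 0 < θ⁻¹ := inv_pos.mpr hθ
  have i1 := ProbabilityTheory.isProbabilityMeasure_gammaMeasure (add_pos hs ht) hr
  have i2 := ProbabilityTheory.isProbabilityMeasureBeta hs ht
  have i3 := ProbabilityTheory.isProbabilityMeasure_gammaMeasure hs hr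
  have i4 := ProbabilityTheory.isProbabilityMeasure_gammaMeasure ht hr
  set r := θ⁻¹
  have hsplit := iem_split s t r hs ht hr
  have hadd := iem_add s t r hs ht hr
  set G := ProbabilityTheory.gammaMeasure (s + t) r
  set S := ProbabilityTheory.gammaMeasure s r
  set T := ProbabilityTheory.gammaMeasure t r
  set β := ProbabilityTheory.betaMeasure s t with hβ
  have mp := (hadd.prod hadd).comp ((iem_mid S S T T).comp
    (((Measure.measurePreserving_swap (μ := S) (ν := S)).prod
      (MeasurePreserving.id (T.prod T))).comp ((iem_mid S T S T).comp
      ((hsplit.prod hsplit).comp (iem_mid G G β β)))))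
  rw [← mp.map_eq, integral_map mp.measurable.aemeasurable hf.aestronglyMeasurable]
  have hint : ∀ {α : Type} [MeasurableSpace α] (μ : Measure α) [IsProbabilityMeasure μ]
      (h : α → ℝ × ℝ), Measurable h → Integrable (fun a => f (h a)) μ := by
    intro α _ μ _ h hh
    exact Integrable.of_bound (hf.comp hh).aestronglyMeasurable C
      (Filter.Eventually.of_forall fun a => hbound _)
  rw [integral_prod _ (hint _ _ mp.measurable)]
  rw [mp.map_eq]
  congr 1
  ext p
  have e : ∀ q : ℝ × ℝ, f ((Prod.map (fun q : ℝ × ℝ => q.1 + q.2) (fun q : ℝ × ℝ => q.1 + q.2) ∘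
      (fun q : (ℝ × ℝ) × (ℝ × ℝ) => ((q.1.1, q.2.1), (q.1.2, q.2.2))) ∘
      Prod.map Prod.swap id ∘
      (fun q : (ℝ × ℝ) × (ℝ × ℝ) => ((q.1.1, q.2.1), (q.1.2, q.2.2))) ∘
      Prod.map (fun q : ℝ × ℝ => (q.1 * q.2, q.1 * (1 - q.2)))
        (fun q : ℝ × ℝ => (q.1 * q.2, q.1 * (1 - q.2))) ∘
      (fun q : (ℝ × ℝ) × (ℝ × ℝ) => ((q.1.1, q.2.1), (q.1.2, q.2.2)))) (p, q))
      = f (p.1 * (1 - q.1) + p.2 * q.2, p.2 * (1 - q.2) + p.1 * q.1) := by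
    intro q
    congr 1
    simp only [Function.comp, Prod.map, Prod.swap, id]
    ext <;> simp only <;> ring
  simp only [e]
  rw [integral_prod _ (hint (β.prod β) (fun q => (p.1 * (1 - q.1) + p.2 * q.2,
    p.2 * (1 - q.2) + p.1 * q.1)) (by fun_prop)), ← iem_beta s t hs ht]
  congr 1
  ext u
  simp only
  rw [← iem_beta s t hs ht, ← intervalIntegral.integral_mul_const]
  congr 1
  ext v
  rw [phiBeta]; ring
end

section
/- Let s,t > 0, let f : [0,∞)² → ℝ be bounded and continuous, and let (n_K)_{K∈ℕ}, (m_K)_{K∈ℕ} be sequences of natural numbers with n_K/K → x and m_K/K → y as K → ∞, for some x,y ≥ 0. Then lim_{K→∞} Σ_{k=0}^{n_K} Σ_{l=0}^{m_K} r_{s,t}(n_K,m_K;k,l) (f((n_K−k+l)/K, (m_K−l+k)/K) − f(n_K/K, m_K/K)) = ∫₀¹∫₀¹ (f(x(1−u)+yv, y(1−v)+xu) − f(x,y)) φ_{s,t}(u,v) du dv. That is, the generator of the rescaled discrete dual process converges to the generator of the continuous generalized Immediate Exchange Model. -/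
open MeasureTheory Finset Filter Real

/-- Beta-binomial(n,s,t) probability mass function. -/
noncomputable def wBB (s t : ℝ) (n k : ℕ) : ℝ :=
  Real.Gamma ((n : ℝ) + 1) * Real.Gamma ((k : ℝ) + s) * Real.Gamma (((n - k : ℕ) : ℝ) + t) *
      Real.Gamma (s + t) /
    (Real.Gamma s * Real.Gamma t * Real.Gamma (s + t + n) * Real.Gamma ((k : ℝ) + 1) *
      Real.Gamma (((n - k : ℕ) : ℝ) + 1))

/-- Redistribution rates of the discrete dual process. -/
noncomputable def rRate (s t : ℝ) (n m k l : ℕ) : ℝ := wBB s t n k * wBB s t m l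

/-- Bernstein basis function. -/
noncomputable def bern (n k : ℕ) (u : ℝ) : ℝ := (n.choose k : ℝ) * u ^ k * (1 - u) ^ (n - k)

/-- One-variable Beta density. -/
noncomputable def bdens (s t u : ℝ) : ℝ := 1 / betaFn s t * (u ^ (s - 1) * (1 - u) ^ (t - 1))

lemma bern_nonneg (n k : ℕ) {u : ℝ} (h0 : 0 ≤ u) (h1 : u ≤ 1) : 0 ≤ bern n k u := by
  have : 0 ≤ 1 - u := by linarith
  unfold bern; positivity

lemma bern_sum (n : ℕ) (u : ℝ) : ∑ k ∈ Finset.range (n + 1), bern n k u = 1 := by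
  have := bernsteinPolynomial.sum ℝ n
  apply_fun fun p => Polynomial.eval u p at this
  simpa [Polynomial.eval_finset_sum, bernsteinPolynomial, bern] using this

lemma bern_var (n : ℕ) (u : ℝ) :
    ∑ k ∈ Finset.range (n + 1), bern n k u * ((k : ℝ) - n * u) ^ 2 = n * u * (1 - u) := by
  have := bernsteinPolynomial.variance ℝ n
  apply_fun fun p => Polynomial.eval u p at this
  simp only [Polynomial.eval_finset_sum, bernsteinPolynomial, nsmul_eq_mul, Polynomial.eval_mul,
    Polynomial.eval_pow, Polynomial.eval_sub, Polynomial.eval_natCast, Polynomial.eval_X,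
    Polynomial.eval_one] at this
  rw [← this]
  refine Finset.sum_congr rfl fun k _ => ?_
  unfold bern; ring

lemma bern_cont (n k : ℕ) : Continuous (bern n k) := by unfold bern; fun_prop

lemma beta_integral {s t : ℝ} (hs : 0 < s) (ht : 0 < t) :
    ∫ u in (0:ℝ)..1, u ^ (s - 1) * (1 - u) ^ (t - 1) = betaFn s t := by
  have h := ProbabilityTheory.beta_eq_betaIntegralReal s t hs ht
  have h2 : Complex.betaIntegral s t
      = ((∫ u in (0:ℝ)..1, u ^ (s - 1) * (1 - u) ^ (t - 1) : ℝ) : ℂ) := by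
    rw [Complex.betaIntegral, ← intervalIntegral.integral_ofReal]
    refine intervalIntegral.integral_congr fun u hu => ?_
    rw [Set.uIcc_of_le zero_le_one] at hu
    have h1 : 0 ≤ 1 - u := by linarith [hu.2]
    simp only [Complex.ofReal_mul]
    rw [Complex.ofReal_cpow hu.1, Complex.ofReal_cpow h1]
    push_cast
    rfl
  rw [h2, Complex.ofReal_re] at h
  rw [← h]; rfl

lemma betaFn_pos {s t : ℝ} (hs : 0 < s) (ht : 0 < t) : 0 < betaFn s t :=
  ProbabilityTheory.beta_pos hs ht

lemma bdens_nonneg {s t u : ℝ} (hs : 0 < s) (ht : 0 < t) (h0 : 0 ≤ u) (h1 : u ≤ 1) :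
    0 ≤ bdens s t u := by
  have : 0 ≤ 1 - u := by linarith
  have := betaFn_pos hs ht
  unfold bdens; positivity

lemma bdens_integrable {s t : ℝ} (hs : 0 < s) (ht : 0 < t) :
    Integrable (bdens s t) (volume.restrict (Set.Ioc 0 1)) := by
  unfold bdens
  refine Integrable.const_mul ?_ _
  by_contra hc
  have h := beta_integral hs ht
  rw [intervalIntegral.integral_of_le zero_le_one, integral_undef hc] at h
  exact (betaFn_pos hs ht).ne h

lemma wBB_eq {s t : ℝ} (hs : 0 < s) (ht : 0 < t) {n k : ℕ} (hk : k ≤ n) :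
    wBB s t n k = ∫ u in Set.Ioc (0:ℝ) 1, bern n k u * bdens s t u := by
  have h := beta_integral (s := k + s) (t := (n - k : ℕ) + t) (by positivity) (by positivity)
  rw [intervalIntegral.integral_of_le zero_le_one, integral_Ioc_eq_integral_Ioo] at h
  rw [integral_Ioc_eq_integral_Ioo]
  have h2 : ∫ u in Set.Ioo (0:ℝ) 1, bern n k u * bdens s t u
      = ∫ u in Set.Ioo (0:ℝ) 1, (n.choose k : ℝ) / betaFn s t *
        (u ^ ((k : ℝ) + s - 1) * (1 - u) ^ (((n - k : ℕ) : ℝ) + t - 1)) := by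
    refine setIntegral_congr_fun measurableSet_Ioo fun u hu => ?_
    have h1 : 0 < 1 - u := by linarith [hu.2]
    simp only [bern, bdens, add_sub_assoc]
    rw [Real.rpow_add hu.1, Real.rpow_add h1, Real.rpow_natCast, Real.rpow_natCast]
    ring
  rw [h2, integral_const_mul, h, Nat.cast_choose ℝ hk]
  have e : (k : ℝ) + s + (((n - k : ℕ) : ℝ) + t) = s + t + n := by
    rw [Nat.cast_sub hk]; ring
  simp only [betaFn, wBB, Real.Gamma_nat_eq_factorial, e]
  have a1 := Real.Gamma_pos_of_pos hs
  have a2 := Real.Gamma_pos_of_pos ht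
  have a3 := Real.Gamma_pos_of_pos (add_pos hs ht)
  have a4 : 0 < Real.Gamma (s + t + n) := Real.Gamma_pos_of_pos (by positivity)
  have a5 : (0:ℝ) < k.factorial := by exact_mod_cast k.factorial_pos
  have a6 : (0:ℝ) < (n-k).factorial := by exact_mod_cast (n-k).factorial_pos
  field_simp

lemma quad_bound {f : ℝ × ℝ → ℝ} (hf : Continuous f) {C : ℝ} (hC : ∀ p, |f p| ≤ C)
    (p : ℝ × ℝ) {ε : ℝ} (hε : 0 < ε) :
    ∃ M, 0 ≤ M ∧ ∀ q : ℝ × ℝ, |f q - f p| ≤ ε + M * ((q.1 - p.1) ^ 2 + (q.2 - p.2) ^ 2) := by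
  obtain ⟨δ, hδ, h⟩ := Metric.continuous_iff.1 hf p ε hε
  have C0 : 0 ≤ C := (abs_nonneg _).trans (hC p)
  refine ⟨2 * C / δ ^ 2, by positivity, fun q => ?_⟩
  by_cases hq : dist q p < δ
  · have := h q hq
    rw [Real.dist_eq] at this
    have : 0 ≤ 2 * C / δ ^ 2 * ((q.1 - p.1) ^ 2 + (q.2 - p.2) ^ 2) := by positivity
    linarith
  · have h1 : |f q - f p| ≤ 2 * C := (abs_sub _ _).trans (by linarith [hC p, hC q])
    have h2 : δ ^ 2 ≤ (q.1 - p.1) ^ 2 + (q.2 - p.2) ^ 2 := by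
      rw [not_lt, Prod.dist_eq, le_max_iff, Real.dist_eq, Real.dist_eq] at hq
      rcases hq with hq | hq
      · have := pow_le_pow_left₀ hδ.le hq 2
        rw [sq_abs] at this
        nlinarith [sq_nonneg (q.2 - p.2)]
      · have := pow_le_pow_left₀ hδ.le hq 2
        rw [sq_abs] at this
        nlinarith [sq_nonneg (q.1 - p.1)]
    have h3 : 2 * C ≤ 2 * C / δ ^ 2 * ((q.1 - p.1) ^ 2 + (q.2 - p.2) ^ 2) := by
      calc 2 * C = 2 * C / δ ^ 2 * δ ^ 2 := by field_simp
        _ ≤ _ := by gcongr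
    linarith

/-- The averaged increment. -/
noncomputable def avgB (f : ℝ × ℝ → ℝ) (K n m : ℕ) (z : ℝ × ℝ) : ℝ :=
  ∑ k ∈ Finset.range (n + 1), ∑ l ∈ Finset.range (m + 1),
    bern n k z.1 * bern m l z.2 *
      (f (((n - k + l : ℕ) : ℝ) / K, ((m - l + k : ℕ) : ℝ) / K) - f ((n : ℝ) / K, (m : ℝ) / K))

lemma double_sum (n m : ℕ) (u v a b c : ℝ) :
    ∑ k ∈ Finset.range (n + 1), ∑ l ∈ Finset.range (m + 1),
      bern n k u * bern m l v * (a + b * ((k : ℝ) - n * u) ^ 2 + c * ((l : ℝ) - m * v) ^ 2)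
      = a + b * (n * u * (1 - u)) + c * (m * v * (1 - v)) := by
  have h : ∀ k ∈ Finset.range (n + 1), ∑ l ∈ Finset.range (m + 1),
      bern n k u * bern m l v * (a + b * ((k : ℝ) - n * u) ^ 2 + c * ((l : ℝ) - m * v) ^ 2)
      = bern n k u * (a + c * (m * v * (1 - v))) + b * (bern n k u * ((k : ℝ) - n * u) ^ 2) := by
    intro k _
    calc _ = (bern n k u * (a + b * ((k : ℝ) - n * u) ^ 2)) *
              ∑ l ∈ Finset.range (m + 1), bern m l v
            + bern n k u * c * ∑ l ∈ Finset.range (m + 1), bern m l v * ((l : ℝ) - m * v) ^ 2 := by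
          rw [Finset.mul_sum, Finset.mul_sum, ← Finset.sum_add_distrib]
          exact Finset.sum_congr rfl fun l _ => by ring
      _ = _ := by rw [bern_sum, bern_var]; ring
  rw [Finset.sum_congr rfl h, Finset.sum_add_distrib, ← Finset.sum_mul, ← Finset.mul_sum,
    bern_sum, bern_var]
  ring

lemma double_sum_one (n m : ℕ) (u v a : ℝ) :
    ∑ k ∈ Finset.range (n + 1), ∑ l ∈ Finset.range (m + 1), bern n k u * bern m l v * a = a := by
  simpa using double_sum n m u v a 0 0

lemma avgB_abs {f : ℝ × ℝ → ℝ} {C : ℝ} (hC : ∀ p, |f p| ≤ C) (K n m : ℕ) {z : ℝ × ℝ}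
    (h1 : z.1 ∈ Set.Icc (0:ℝ) 1) (h2 : z.2 ∈ Set.Icc (0:ℝ) 1) : |avgB f K n m z| ≤ 2 * C := by
  rw [← double_sum_one n m z.1 z.2 (2 * C)]
  refine (Finset.abs_sum_le_sum_abs _ _).trans (Finset.sum_le_sum fun k _ => ?_)
  refine (Finset.abs_sum_le_sum_abs _ _).trans (Finset.sum_le_sum fun l _ => ?_)
  have a := bern_nonneg n k h1.1 h1.2
  have b := bern_nonneg m l h2.1 h2.2
  rw [abs_mul, abs_of_nonneg (mul_nonneg a b)]
  gcongr
  exact (abs_sub _ _).trans (by linarith [hC (((n - k + l : ℕ) : ℝ) / K, ((m - l + k : ℕ) : ℝ) / K), hC ((n : ℝ) / K, (m : ℝ) / K)])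

lemma avgB_cont (f : ℝ × ℝ → ℝ) (K n m : ℕ) : Continuous (avgB f K n m) := by
  unfold avgB
  refine continuous_finset_sum _ fun k _ => continuous_finset_sum _ fun l _ => ?_
  have := bern_cont n k
  have := bern_cont m l
  fun_prop

lemma sq_four (A B a b u v : ℝ) (hu0 : 0 ≤ u) (hu1 : u ≤ 1) (hv0 : 0 ≤ v) (hv1 : v ≤ 1) :
    (A * (1 - u) - a + b + B * v) ^ 2 ≤ 4 * (A ^ 2 + B ^ 2 + a ^ 2 + b ^ 2) := by
  have e1 : (A * (1 - u)) ^ 2 ≤ A ^ 2 := by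
    rw [mul_pow]
    have : (1 - u) ^ 2 ≤ 1 := by nlinarith
    nlinarith [sq_nonneg A]
  have e2 : (B * v) ^ 2 ≤ B ^ 2 := by
    rw [mul_pow]
    have : v ^ 2 ≤ 1 := by nlinarith
    nlinarith [sq_nonneg B]
  generalize A * (1 - u) = X at *
  generalize B * v = Y at *
  nlinarith [sq_nonneg (X + a), sq_nonneg (X - b), sq_nonneg (X - Y), sq_nonneg (a + b),
    sq_nonneg (a + Y), sq_nonneg (b - Y)]

lemma avgB_bound {f : ℝ × ℝ → ℝ} {x y u v ε M : ℝ} (hM : 0 ≤ M)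
    (hu0 : 0 ≤ u) (hu1 : u ≤ 1) (hv0 : 0 ≤ v) (hv1 : v ≤ 1) {p : ℝ × ℝ}
    (hp : p = (x * (1 - u) + y * v, y * (1 - v) + x * u))
    (h : ∀ q : ℝ × ℝ, |f q - f p| ≤ ε + M * ((q.1 - p.1) ^ 2 + (q.2 - p.2) ^ 2))
    (K n m : ℕ) (hK : K ≠ 0) :
    |avgB f K n m (u, v) - (f p - f ((n : ℝ) / K, (m : ℝ) / K))| ≤
      ε + 8 * M * (((n : ℝ) / K - x) ^ 2 + ((m : ℝ) / K - y) ^ 2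
        + (n : ℝ) / K * (1 / K) * (u * (1 - u)) + (m : ℝ) / K * (1 / K) * (v * (1 - v))) := by
  have hK' : (K : ℝ) ≠ 0 := by exact_mod_cast hK
  have key := double_sum n m u v
    (ε + 8 * M * (((n : ℝ) / K - x) ^ 2 + ((m : ℝ) / K - y) ^ 2)) (8 * M / K ^ 2) (8 * M / K ^ 2)
  have e : ε + 8 * M * (((n : ℝ) / K - x) ^ 2 + ((m : ℝ) / K - y) ^ 2
        + (n : ℝ) / K * (1 / K) * (u * (1 - u)) + (m : ℝ) / K * (1 / K) * (v * (1 - v)))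
      = ε + 8 * M * (((n : ℝ) / K - x) ^ 2 + ((m : ℝ) / K - y) ^ 2)
        + 8 * M / K ^ 2 * (n * u * (1 - u)) + 8 * M / K ^ 2 * (m * v * (1 - v)) := by
    field_simp
    ring
  rw [e, ← key, ← double_sum_one n m u v (f p - f ((n : ℝ) / K, (m : ℝ) / K)), avgB,
    ← Finset.sum_sub_distrib]
  refine (Finset.abs_sum_le_sum_abs _ _).trans (Finset.sum_le_sum fun k hk => ?_)
  rw [← Finset.sum_sub_distrib]
  refine (Finset.abs_sum_le_sum_abs _ _).trans (Finset.sum_le_sum fun l hl => ?_)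
  have hk : k ≤ n := by simpa [Nat.lt_succ_iff] using hk
  have hl : l ≤ m := by simpa [Nat.lt_succ_iff] using hl
  have a := bern_nonneg n k hu0 hu1
  have b := bern_nonneg m l hv0 hv1
  rw [← mul_sub, abs_mul, abs_of_nonneg (mul_nonneg a b), sub_sub_sub_cancel_right]
  refine mul_le_mul_of_nonneg_left ?_ (mul_nonneg a b)
  refine (h _).trans ?_
  have s1 := sq_four (n / K - x) (m / K - y) ((k - n * u) / K) ((l - m * v) / K) u v hu0 hu1 hv0 hv1
  have s2 := sq_four (m / K - y) (n / K - x) ((l - m * v) / K) ((k - n * u) / K) v u hv0 hv1 hu0 hu1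
  have r1 : ((n - k + l : ℕ) : ℝ) / K - (x * (1 - u) + y * v) =
      (n / K - x) * (1 - u) - (k - n * u) / K + (l - m * v) / K + (m / K - y) * v := by
    push_cast [Nat.cast_sub hk]; field_simp; ring
  have r2 : ((m - l + k : ℕ) : ℝ) / K - (y * (1 - v) + x * u) =
      (m / K - y) * (1 - v) - (l - m * v) / K + (k - n * u) / K + (n / K - x) * u := by
    push_cast [Nat.cast_sub hl]; field_simp; ring
  rw [← r1] at s1
  rw [← r2] at s2
  subst hp
  have := mul_le_mul_of_nonneg_left (add_le_add s1 s2) hM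
  refine (add_le_add_right this ε).trans (le_of_eq ?_)
  field_simp
  ring

lemma avgB_tendsto {f : ℝ × ℝ → ℝ} (hf : Continuous f) {C : ℝ} (hC : ∀ p, |f p| ≤ C)
    {x y u v : ℝ} (hu0 : 0 ≤ u) (hu1 : u ≤ 1) (hv0 : 0 ≤ v) (hv1 : v ≤ 1) (nK mK : ℕ → ℕ)
    (hn : Tendsto (fun K : ℕ => (nK K : ℝ) / K) atTop (nhds x))
    (hm : Tendsto (fun K : ℕ => (mK K : ℝ) / K) atTop (nhds y)) :
    Tendsto (fun K : ℕ => avgB f K (nK K) (mK K) (u, v)) atTop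
      (nhds (f (x * (1 - u) + y * v, y * (1 - v) + x * u) - f (x, y))) := by
  set p : ℝ × ℝ := (x * (1 - u) + y * v, y * (1 - v) + x * u) with hp
  have h1 : Tendsto (fun K : ℕ => f p - f ((nK K : ℝ) / K, (mK K : ℝ) / K)) atTop
      (nhds (f p - f (x, y))) :=
    tendsto_const_nhds.sub ((hf.tendsto (x, y)).comp (hn.prodMk_nhds hm))
  suffices h2 : Tendsto (fun K : ℕ => avgB f K (nK K) (mK K) (u, v) -
      (f p - f ((nK K : ℝ) / K, (mK K : ℝ) / K))) atTop (nhds 0) by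
    simpa using h2.add h1
  rw [Metric.tendsto_nhds]
  intro ε hε
  obtain ⟨M, hM, hq⟩ := quad_bound hf hC p (half_pos hε)
  have hi : Tendsto (fun K : ℕ => 1 / (K : ℝ)) atTop (nhds 0) := tendsto_one_div_atTop_nhds_zero_nat
  have h3 : Tendsto (fun K : ℕ => ε / 2 + 8 * M * (((nK K : ℝ) / K - x) ^ 2
        + ((mK K : ℝ) / K - y) ^ 2
        + (nK K : ℝ) / K * (1 / K) * (u * (1 - u)) + (mK K : ℝ) / K * (1 / K) * (v * (1 - v))))
      atTop (nhds (ε / 2 + 8 * M * ((x - x) ^ 2 + (y - y) ^ 2 + x * 0 * (u * (1 - u))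
        + y * 0 * (v * (1 - v))))) :=
    tendsto_const_nhds.add (tendsto_const_nhds.mul
      (((((hn.sub_const x).pow 2).add ((hm.sub_const y).pow 2)).add
        ((hn.mul hi).mul_const _)).add ((hm.mul hi).mul_const _)))
  have h4 := h3.eventually_lt_const (u := ε) (by simp [hε])
  filter_upwards [h4, eventually_ne_atTop 0] with K hK hK0
  rw [Real.dist_eq, sub_zero]
  exact (avgB_bound hM hu0 hu1 hv0 hv1 hp hq K _ _ hK0).trans_lt hK

lemma sum_eq_integral {s t : ℝ} (hs : 0 < s) (ht : 0 < t) (f : ℝ × ℝ → ℝ) (K n m : ℕ) :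
    ∑ k ∈ Finset.range (n + 1), ∑ l ∈ Finset.range (m + 1),
        rRate s t n m k l *
          (f (((n - k + l : ℕ) : ℝ) / K, ((m - l + k : ℕ) : ℝ) / K)
            - f ((n : ℝ) / K, (m : ℝ) / K))
      = ∫ z, avgB f K n m z * (bdens s t z.1 * bdens s t z.2)
        ∂((volume.restrict (Set.Ioc (0:ℝ) 1)).prod (volume.restrict (Set.Ioc (0:ℝ) 1))) := by
  have hI : ∀ n k : ℕ, Integrable (fun u => bern n k u * bdens s t u)
      (volume.restrict (Set.Ioc (0:ℝ) 1)) := by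
    intro n k
    obtain ⟨c, hc⟩ := (isCompact_Icc (a := (0:ℝ)) (b := 1)).exists_bound_of_continuousOn
      (bern_cont n k).continuousOn
    refine (bdens_integrable hs ht).bdd_mul (c := c) (bern_cont n k).aestronglyMeasurable ?_
    filter_upwards [ae_restrict_mem measurableSet_Ioc] with u hu
    exact hc u (Set.Ioc_subset_Icc_self hu)
  have hP : ∀ (k l : ℕ) (c : ℝ), Integrable (fun z : ℝ × ℝ =>
      (bern n k z.1 * bdens s t z.1) * (bern m l z.2 * bdens s t z.2) * c)
      ((volume.restrict (Set.Ioc (0:ℝ) 1)).prod (volume.restrict (Set.Ioc (0:ℝ) 1))) :=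
    fun k l c => ((hI n k).mul_prod (hI m l)).mul_const c
  have e : ∀ z : ℝ × ℝ, avgB f K n m z * (bdens s t z.1 * bdens s t z.2) =
      ∑ k ∈ Finset.range (n + 1), ∑ l ∈ Finset.range (m + 1),
        (bern n k z.1 * bdens s t z.1) * (bern m l z.2 * bdens s t z.2) *
        (f (((n - k + l : ℕ) : ℝ) / K, ((m - l + k : ℕ) : ℝ) / K)
          - f ((n : ℝ) / K, (m : ℝ) / K)) := by
    intro z
    rw [avgB, Finset.sum_mul]
    refine Finset.sum_congr rfl fun k _ => ?_
    rw [Finset.sum_mul]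
    exact Finset.sum_congr rfl fun l _ => by ring
  simp_rw [e]
  rw [integral_finset_sum _ fun k _ => integrable_finset_sum _ fun l _ => hP k l _]
  refine Finset.sum_congr rfl fun k hk => ?_
  rw [integral_finset_sum _ fun l _ => hP k l _]
  refine Finset.sum_congr rfl fun l hl => ?_
  have hk : k ≤ n := by simpa [Nat.lt_succ_iff] using hk
  have hl : l ≤ m := by simpa [Nat.lt_succ_iff] using hl
  rw [integral_mul_const, integral_prod_mul (fun u => bern n k u * bdens s t u)
    (fun u => bern m l u * bdens s t u), ← wBB_eq hs ht hk, ← wBB_eq hs ht hl, rRate]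

/-- Scaling limit: for bounded continuous f and sequences n_K/K → x,
m_K/K → y, the generator of the rescaled discrete dual process converges to the generator
of the continuous generalized Immediate Exchange Model. -/
theorem discrete_dual_generator_scaling_limit
    (s t : ℝ) (hs : 0 < s) (ht : 0 < t)
    (f : ℝ × ℝ → ℝ) (hf : Continuous f) (C : ℝ) (hbound : ∀ p, |f p| ≤ C)
    (x y : ℝ) (hx : 0 ≤ x) (hy : 0 ≤ y)
    (nK mK : ℕ → ℕ)
    (hn : Tendsto (fun K : ℕ => (nK K : ℝ) / K) atTop (nhds x))
    (hm : Tendsto (fun K : ℕ => (mK K : ℝ) / K) atTop (nhds y)) :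
    Tendsto
      (fun K : ℕ => ∑ k ∈ Finset.range (nK K + 1), ∑ l ∈ Finset.range (mK K + 1),
        rRate s t (nK K) (mK K) k l *
          (f (((nK K - k + l : ℕ) : ℝ) / K, ((mK K - l + k : ℕ) : ℝ) / K)
            - f ((nK K : ℝ) / K, (mK K : ℝ) / K)))
      atTop
      (nhds (∫ u in (0:ℝ)..1, ∫ v in (0:ℝ)..1,
        (f (x * (1 - u) + y * v, y * (1 - v) + x * u) - f (x, y)) * phiBeta s t u v)) := by
  set ν := volume.restrict (Set.Ioc (0:ℝ) 1) with hν
  have hD : Integrable (fun z : ℝ × ℝ => bdens s t z.1 * bdens s t z.2) (ν.prod ν) :=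
    (bdens_integrable hs ht).mul_prod (bdens_integrable hs ht)
  have hmem : ∀ᵐ z ∂(ν.prod ν), z.1 ∈ Set.Icc (0:ℝ) 1 ∧ z.2 ∈ Set.Icc (0:ℝ) 1 := by
    rw [hν, Measure.prod_restrict]
    filter_upwards [ae_restrict_mem (measurableSet_Ioc.prod measurableSet_Ioc)] with z hz
    exact ⟨Set.Ioc_subset_Icc_self hz.1, Set.Ioc_subset_Icc_self hz.2⟩
  have hG : Continuous (fun z : ℝ × ℝ =>
      f (x * (1 - z.1) + y * z.2, y * (1 - z.2) + x * z.1) - f (x, y)) := by fun_prop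
  have hlim : ∫ u in (0:ℝ)..1, ∫ v in (0:ℝ)..1,
        (f (x * (1 - u) + y * v, y * (1 - v) + x * u) - f (x, y)) * phiBeta s t u v
      = ∫ z, (f (x * (1 - z.1) + y * z.2, y * (1 - z.2) + x * z.1) - f (x, y)) *
          (bdens s t z.1 * bdens s t z.2) ∂(ν.prod ν) := by
    rw [integral_prod, intervalIntegral.integral_of_le zero_le_one]
    · refine integral_congr_ae (Eventually.of_forall fun u => ?_)
      simp only
      rw [intervalIntegral.integral_of_le zero_le_one]
      refine integral_congr_ae (Eventually.of_forall fun v => ?_)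
      simp only [phiBeta, bdens]
      ring
    · refine hD.bdd_mul (c := 2 * C) hG.aestronglyMeasurable (Eventually.of_forall fun z => ?_)
      rw [Real.norm_eq_abs]
      exact (abs_sub _ _).trans (by
        linarith [hbound (x * (1 - z.1) + y * z.2, y * (1 - z.2) + x * z.1), hbound (x, y)])
  rw [hlim]
  simp_rw [sum_eq_integral hs ht f]
  refine tendsto_integral_filter_of_dominated_convergence
    (fun z => 2 * C * (bdens s t z.1 * bdens s t z.2)) ?_ ?_ (hD.const_mul _) ?_
  · exact Eventually.of_forall fun K =>
      (avgB_cont f K _ _).aestronglyMeasurable.mul hD.aestronglyMeasurable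
  · refine Eventually.of_forall fun K => ?_
    filter_upwards [hmem] with z hz
    have a := bdens_nonneg hs ht hz.1.1 hz.1.2
    have b := bdens_nonneg hs ht hz.2.1 hz.2.2
    rw [norm_mul, Real.norm_eq_abs, Real.norm_eq_abs, abs_of_nonneg (mul_nonneg a b)]
    exact mul_le_mul_of_nonneg_right (avgB_abs hbound _ _ _ hz.1 hz.2) (mul_nonneg a b)
  · filter_upwards [hmem] with z hz
    exact (avgB_tendsto hf hbound hz.1.1 hz.1.2 hz.2.1 hz.2.2 nK mK hn hm).mul_const _
end
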